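/- For every finite multigraph Γ there exists a polynomial φ_Γ with rational coefficients such that for every positive integer k, φ_Γ(k) equals the number of nowhere-zero integral k-flows on Γ (in any fixed orientation). -/

import Mathlib

open Finset

def PolyF (f : ℕ → ℚ) : Prop := ∃ p : Polynomial ℚ, ∀ k : ℕ, 1 ≤ k → p.eval (k : ℚ) = f k

lemma PolyF.add {f g : ℕ → ℚ} (hf : PolyF f) (hg : PolyF g) : PolyF (fun k => f k + g k) := by
  obtain ⟨p, hp⟩ := hf
  obtain ⟨q, hq⟩ := hg
  exact ⟨p + q, fun k hk => by rw [Polynomial.eval_add, hp k hk, hq k hk]⟩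

lemma PolyF.sub {f g : ℕ → ℚ} (hf : PolyF f) (hg : PolyF g) : PolyF (fun k => f k - g k) := by
  obtain ⟨p, hp⟩ := hf
  obtain ⟨q, hq⟩ := hg
  exact ⟨p - q, fun k hk => by rw [Polynomial.eval_sub, hp k hk, hq k hk]⟩

lemma PolyF.congr {f g : ℕ → ℚ} (hf : PolyF f) (h : ∀ k, 1 ≤ k → f k = g k) : PolyF g := by
  obtain ⟨p, hp⟩ := hf
  exact ⟨p, fun k hk => by rw [hp k hk, h k hk]⟩

lemma PolyF.zero : PolyF (fun _ => 0) := ⟨0, fun k _ => by simp⟩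

lemma PolyF.const (c : ℚ) : PolyF (fun _ => c) := ⟨Polynomial.C c, fun k _ => by simp⟩

lemma PolyF.sum {ι : Type*} (s : Finset ι) (f : ι → ℕ → ℚ) (h : ∀ i ∈ s, PolyF (f i)) :
    PolyF (fun k => ∑ i ∈ s, f i k) := by
  classical
  induction s using Finset.induction_on with
  | empty => simpa using PolyF.zero
  | insert a s ha ih =>
    refine ((h a (mem_insert_self _ _)).add
      (ih fun i hi => h i (mem_insert_of_mem hi))).congr fun k _ => ?_
    rw [Finset.sum_insert ha]

lemma exists_sum_poly (q : Polynomial ℚ) :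
    ∃ p : Polynomial ℚ, ∀ n : ℕ, p.eval (n : ℚ) = ∑ j ∈ range n, q.eval (j : ℚ) := by
  induction q using Polynomial.induction_on' with
  | add a b ha hb =>
    obtain ⟨p, hp⟩ := ha
    obtain ⟨r, hr⟩ := hb
    exact ⟨p + r, fun n => by simp [hp, hr, Finset.sum_add_distrib]⟩
  | monomial m c =>
    refine ⟨∑ i ∈ range (m + 1), Polynomial.C (c * (bernoulli i * ((m + 1).choose i) / (m + 1)))
      * Polynomial.X ^ (m + 1 - i), fun n => ?_⟩
    simp only [Polynomial.eval_monomial]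
    rw [← Finset.mul_sum, sum_range_pow, Polynomial.eval_finsetSum, Finset.mul_sum]
    refine Finset.sum_congr rfl fun i _ => ?_
    simp
    ring

/-- a function whose backward differences are polynomial is polynomial -/
lemma PolyF.of_diff {f g : ℕ → ℚ} (hg : PolyF g) (h : ∀ k, 1 ≤ k → f (k + 1) - f k = g (k + 1)) :
    PolyF f := by
  obtain ⟨q, hq⟩ := hg
  obtain ⟨p, hp⟩ := exists_sum_poly (q.comp (Polynomial.X + 1))
  refine ⟨p + Polynomial.C (f 1 - p.eval 1), fun k hk => ?_⟩
  induction k, hk using Nat.le_induction with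
  | base => simp
  | succ k hk ih =>
    have h1 := h k hk
    have h2 := hq (k + 1) (by omega)
    have e : p.eval ((k + 1 : ℕ) : ℚ) = p.eval (k : ℚ) + q.eval ((k + 1 : ℕ) : ℚ) := by
      rw [hp, hp, Finset.sum_range_succ]
      simp
    simp only [Polynomial.eval_add, Polynomial.eval_C] at ih ⊢
    rw [e, h2]
    linarith

/-- incidence coefficient -/
def inc {V E : Type} [DecidableEq V] (head tail : E → V) (e : E) (v : V) : ℤ :=
  (if head e = v then 1 else 0) - (if tail e = v then 1 else 0)

section
variable {V E : Type} [Fintype V] [Fintype E] [DecidableEq V] [DecidableEq E] (head tail : E → V)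

lemma inc_sum (x : E → ℤ) (v : V) :
    ∑ e, x e * inc head tail e v =
      ∑ e ∈ univ.filter (fun e => head e = v), x e
                - ∑ e ∈ univ.filter (fun e => tail e = v), x e := by
  simp [inc, mul_sub, Finset.sum_filter]

lemma card_incident (F : Finset E) (y : E → ℚ) (d : V → ℤ)
    (hF : ∀ e ∈ F, 0 < y e ∧ y e < 1) (hnF : ∀ e, e ∉ F → ∃ n : ℤ, y e = n)
    (hy : ∀ v, ∑ e, y e * (inc head tail e v : ℚ) = d v) :
    (F.image head ∪ F.image tail).card ≤ F.card := by
  set W := F.image head ∪ F.image tail with hW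
  have key : ∀ v ∈ W, 2 ≤ (F.filter (fun e => head e = v)).card
      + (F.filter (fun e => tail e = v)).card := by
    intro v hv
    by_contra hlt
    have hpos : 1 ≤ (F.filter (fun e => head e = v)).card
      + (F.filter (fun e => tail e = v)).card := by
      rw [hW, mem_union, mem_image, mem_image] at hv
      rcases hv with ⟨e, he, hev⟩ | ⟨e, he, hev⟩
      · have : 0 < (F.filter (fun e => head e = v)).card :=
          card_pos.2 ⟨e, by simp [he, hev]⟩
        omega
      · have : 0 < (F.filter (fun e => tail e = v)).card :=
          card_pos.2 ⟨e, by simp [he, hev]⟩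
        omega
    -- the part of the sum in F is an integer
    have hint : ∃ n : ℤ, ∑ e ∈ F, y e * (inc head tail e v : ℚ) = n := by
      choose! g hg using hnF
      refine ⟨d v - ∑ e ∈ univ \ F, g e * inc head tail e v, ?_⟩
      push_cast
      rw [← hy v, ← Finset.sum_sdiff (subset_univ F), eq_sub_iff_add_eq, add_comm]
      congr 1
      refine Finset.sum_congr rfl fun e he => ?_
      rw [hg e (by simpa using he)]
    obtain ⟨n, hn⟩ := hint
    have hsum : ∑ e ∈ F, y e * (inc head tail e v : ℚ) =
        ∑ e ∈ F.filter (fun e => head e = v), y e - ∑ e ∈ F.filter (fun e => tail e = v), y e := by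
      simp [inc, mul_sub, Finset.sum_filter]
    rw [hsum] at hn
    have hcase : ((F.filter (fun e => head e = v)).card = 1 ∧
        (F.filter (fun e => tail e = v)).card = 0) ∨
        ((F.filter (fun e => head e = v)).card = 0 ∧
        (F.filter (fun e => tail e = v)).card = 1) := by omega
    rcases hcase with ⟨h1, h0⟩ | ⟨h0, h1⟩
    · obtain ⟨e, he⟩ := card_eq_one.1 h1
      rw [card_eq_zero] at h0
      have heF : e ∈ F := (mem_filter.1 (he ▸ mem_singleton_self e)).1
      rw [he, h0, sum_singleton, sum_empty, sub_zero] at hn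
      have := hF e heF
      rw [hn] at this
      have a1 : 0 < n := by exact_mod_cast this.1
      have a2 : n < 1 := by exact_mod_cast this.2
      omega
    · obtain ⟨e, he⟩ := card_eq_one.1 h1
      rw [card_eq_zero] at h0
      have heF : e ∈ F := (mem_filter.1 (he ▸ mem_singleton_self e)).1
      rw [he, h0, sum_singleton, sum_empty, zero_sub] at hn
      have := hF e heF
      rw [show y e = ((-n : ℤ) : ℚ) by push_cast; linarith] at this
      have a1 : 0 < -n := by exact_mod_cast this.1
      have a2 : -n < 1 := by exact_mod_cast this.2
      omega
  have h1 := Finset.card_eq_sum_card_fiberwise (s := F) (t := W) (f := head)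
    (fun e he => by
      simp only [hW, coe_union, coe_image, Set.mem_union]
      exact Or.inl ⟨e, he, rfl⟩)
  have h2 := Finset.card_eq_sum_card_fiberwise (s := F) (t := W) (f := tail)
    (fun e he => by
      simp only [hW, coe_union, coe_image, Set.mem_union]
      exact Or.inr ⟨e, he, rfl⟩)
  have h3 := Finset.sum_le_sum key
  rw [Finset.sum_add_distrib, ← h1, ← h2, Finset.sum_const, smul_eq_mul] at h3
  omega

lemma exists_kernel (F : Finset E) (hne : F.Nonempty)
    (hc : (F.image head ∪ F.image tail).card ≤ F.card) :
    ∃ z : E → ℚ, (∃ e, z e ≠ 0) ∧ (∀ e, e ∉ F → z e = 0) ∧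
      ∀ v, ∑ e, z e * (inc head tail e v : ℚ) = 0 := by
  obtain ⟨e0, he0⟩ := hne
  set W := F.image head ∪ F.image tail with hW
  have hv0 : head e0 ∈ W := by simp only [hW, mem_union, mem_image]; exact Or.inl ⟨e0, he0, rfl⟩
  set v0 := head e0
  let L : (F → ℚ) →ₗ[ℚ] ({v // v ∈ W.erase v0} → ℚ) :=
    { toFun := fun z v => ∑ e : F, z e * (inc head tail e.1 v.1 : ℚ)
      map_add' := by
        intro a b; ext v; simp [add_mul, Finset.sum_add_distrib]
      map_smul' := by
        intro a b; ext v; simp [Finset.mul_sum, mul_assoc] }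
  have hlt : Module.finrank ℚ ({v // v ∈ W.erase v0} → ℚ) < Module.finrank ℚ (F → ℚ) := by
    simp only [Module.finrank_fintype_fun_eq_card, Fintype.card_coe]
    rw [card_erase_of_mem hv0]
    have : 0 < W.card := card_pos.2 ⟨_, hv0⟩
    omega
  have hker := LinearMap.ker_ne_bot_of_finrank_lt (f := L) hlt
  obtain ⟨z, hz, hz0⟩ := (Submodule.ne_bot_iff _).1 hker
  rw [LinearMap.mem_ker] at hz
  let z' : E → ℚ := fun e => if h : e ∈ F then z ⟨e, h⟩ else 0
  have hs : ∀ v, ∑ e, z' e * (inc head tail e v : ℚ)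
      = ∑ e : F, z e * (inc head tail e.1 v : ℚ) := by
    intro v
    rw [← Finset.sum_subset (subset_univ F), ← Finset.sum_coe_sort]
    · refine Finset.sum_congr rfl fun e _ => ?_
      simp [z']
    · intro e _ he
      simp [z', he]
  have h1 : ∀ v, v ≠ v0 → ∑ e, z' e * (inc head tail e v : ℚ) = 0 := by
    intro v hv
    by_cases hvW : v ∈ W
    · rw [hs]
      exact congrFun hz ⟨v, mem_erase.2 ⟨hv, hvW⟩⟩
    · refine Finset.sum_eq_zero fun e _ => ?_
      by_cases he : e ∈ F
      · have a1 : head e ≠ v := by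
          rintro rfl
          exact hvW (by simp only [hW, mem_union, mem_image]; exact Or.inl ⟨e, he, rfl⟩)
        have a2 : tail e ≠ v := by
          rintro rfl
          exact hvW (by simp only [hW, mem_union, mem_image]; exact Or.inr ⟨e, he, rfl⟩)
        simp [inc, a1, a2]
      · simp [z', he]
  refine ⟨z', ?_, ?_, ?_⟩
  · by_contra hall
    push Not at hall
    apply hz0
    ext e
    have := hall e.1
    simpa [z'] using this
  · intro e he
    simp [z', he]
  · intro v
    by_cases hv : v = v0
    · have ht : ∑ v, ∑ e, z' e * (inc head tail e v : ℚ) = 0 := by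
        rw [Finset.sum_comm]
        refine Finset.sum_eq_zero fun e _ => ?_
        rw [← Finset.mul_sum]
        simp [inc]
      rw [Finset.sum_eq_single v0 (fun b _ hb => h1 b hb) (by simp)] at ht
      rw [hv, ht]
    · exact h1 v hv

lemma rounding (d : V → ℤ) : ∀ (n : ℕ) (y : E → ℚ),
    (univ.filter (fun e => 0 < y e ∧ y e < 1)).card = n → (∀ e, 0 ≤ y e ∧ y e ≤ 1) →
    (∀ v, ∑ e, y e * (inc head tail e v : ℚ) = d v) →
    ∃ u : E → ℤ, (∀ e, 0 ≤ u e ∧ u e ≤ 1) ∧ (∀ v, ∑ e, u e * inc head tail e v = d v) ∧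
      ∀ e, (y e = 0 → u e = 0) ∧ (y e = 1 → u e = 1) := by
  intro n
  induction n using Nat.strong_induction_on with
  | _ n ih =>
  intro y hn hy hd
  set F := univ.filter (fun e => 0 < y e ∧ y e < 1) with hFdef
  have hnF : ∀ e, e ∉ F → y e = 0 ∨ y e = 1 := by
    intro e he
    simp only [hFdef, mem_filter, mem_univ, true_and, not_and, not_lt] at he
    rcases (hy e).1.eq_or_lt with h | h
    · exact Or.inl h.symm
    · exact Or.inr (le_antisymm (hy e).2 (he h))
  rcases F.eq_empty_or_nonempty with hF | hF
  · have h01 : ∀ e, y e = ((if y e = 0 then 0 else 1 : ℤ) : ℚ) := by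
      intro e
      rcases hnF e (by simp [hF]) with h | h <;> simp [h]
    refine ⟨fun e => if y e = 0 then 0 else 1, ?_, ?_, ?_⟩
    · intro e
      dsimp only
      split_ifs <;> simp
    · intro v
      have := hd v
      rw [Finset.sum_congr rfl (fun e _ => by rw [h01 e])] at this
      exact_mod_cast this
    · intro e
      constructor
      · intro h; simp [h]
      · intro h; simp [h]
  · have hFm : ∀ e ∈ F, 0 < y e ∧ y e < 1 := fun e he => (mem_filter.1 he).2
    have hcard := card_incident head tail F y d hFm
      (fun e he => by
        rcases hnF e he with h | h
        · exact ⟨0, by simp [h]⟩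
        · exact ⟨1, by simp [h]⟩) hd
    obtain ⟨z, ⟨e1, he1⟩, hz0, hz⟩ := exists_kernel head tail F hF hcard
    let t : E → ℚ := fun e => if 0 < z e then (1 - y e) / z e else - y e / z e
    obtain ⟨e2, he2, hmin⟩ := Finset.exists_min_image (univ.filter (fun e => z e ≠ 0)) t
      ⟨e1, by simp [he1]⟩
    have hz2 : z e2 ≠ 0 := (mem_filter.1 he2).2
    have hmemF : ∀ e, z e ≠ 0 → e ∈ F := fun e he => by
      by_contra h; exact he (hz0 e h)
    have htpos : 0 ≤ t e2 := by
      have := hFm e2 (hmemF e2 hz2)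
      simp only [t]
      split_ifs with h
      · exact div_nonneg (by linarith) h.le
      · exact div_nonneg_of_nonpos (by linarith) (not_lt.1 h)
    set s := t e2 with hs
    let y' : E → ℚ := fun e => y e + s * z e
    have hy'eq : ∀ e, e ∉ F → y' e = y e := fun e he => by simp [y', hz0 e he]
    have hy' : ∀ e, 0 ≤ y' e ∧ y' e ≤ 1 := by
      intro e
      rcases lt_trichotomy (z e) 0 with h | h | h
      · have hm := hmin e (by simp [h.ne])
        simp only [t, not_lt.2 h.le, if_false] at hm
        have hm' : s ≤ - y e / z e := hm
        rw [le_div_iff_of_neg h] at hm'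
        have := mul_nonpos_of_nonneg_of_nonpos htpos h.le
        have := hy e
        simp only [y']
        constructor <;> linarith
      · simpa [y', h] using hy e
      · have hm := hmin e (by simp [h.ne'])
        simp only [t, h, if_true] at hm
        have hm' : s ≤ (1 - y e) / z e := hm
        rw [le_div_iff₀ h] at hm'
        have := mul_nonneg htpos h.le
        have := hy e
        simp only [y']
        constructor <;> linarith
    have hy'2 : y' e2 = 0 ∨ y' e2 = 1 := by
      simp only [y', hs, t]
      split_ifs with h
      · right; field_simp; ring
      · left; field_simp; ring
    have hsub : univ.filter (fun e => 0 < y' e ∧ y' e < 1) ⊂ F := by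
      rw [Finset.ssubset_iff_of_subset]
      · refine ⟨e2, hmemF e2 hz2, ?_⟩
        rcases hy'2 with h | h <;> simp [h]
      · intro e he
        by_contra hne
        have := (mem_filter.1 he).2
        rw [hy'eq e hne] at this
        exact hne (by simp [hFdef, this])
    obtain ⟨u, hu1, hu2, hu3⟩ := ih _ (hn ▸ card_lt_card hsub) y' rfl hy' (by
      intro v
      simp only [y', add_mul, Finset.sum_add_distrib, mul_assoc, ← Finset.mul_sum, hz v, hd v]
      simp)
    refine ⟨u, hu1, hu2, fun e => ?_⟩
    constructor
    · intro h
      refine (hu3 e).1 ?_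
      rw [hy'eq e, h]
      intro hf; linarith [(hFm e hf).1]
    · intro h
      refine (hu3 e).2 ?_
      rw [hy'eq e, h]
      intro hf; linarith [(hFm e hf).2]

/-- lattice points of the `k`-th dilate of a face, with forbidden values -/
noncomputable def pts (d : V → ℤ) (G : Finset E) (w : E → ℤ) (k : ℕ) : Finset (E → ℤ) :=
  (Fintype.piFinset (fun _ => Finset.Icc (0 : ℤ) k)).filter (fun x =>
    (∀ e, e ∉ G → x e = k * w e) ∧ ∀ v, ∑ e, x e * inc head tail e v = k * d v)

lemma mem_pts {d : V → ℤ} {G : Finset E} {w : E → ℤ} {k : ℕ} {x : E → ℤ} :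
    x ∈ pts head tail d G w k ↔ (∀ e, 0 ≤ x e ∧ x e ≤ k) ∧
      (∀ e, e ∉ G → x e = k * w e) ∧ ∀ v, ∑ e, x e * inc head tail e v = k * d v := by
  simp [pts, Fintype.mem_piFinset]

lemma pts_fix {d : V → ℤ} {G : Finset E} {w : E → ℤ} {k : ℕ} {a : E} (ha : a ∈ G) (c : ℤ) :
    pts head tail d (G.erase a) (Function.update w a c) k =
      (pts head tail d G w k).filter (fun x => x a = k * c) := by
  ext x
  simp only [mem_filter, mem_pts, mem_erase]
  constructor
  · rintro ⟨h1, h2, h3⟩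
    refine ⟨⟨h1, ?_, h3⟩, ?_⟩
    · intro e he
      have := h2 e (by tauto)
      rwa [Function.update_of_ne (by rintro rfl; exact he ha)] at this
    · have := h2 a (by tauto)
      rwa [Function.update_self] at this
  · rintro ⟨⟨h1, h2, h3⟩, h4⟩
    refine ⟨h1, ?_, h3⟩
    intro e he
    by_cases hea : e = a
    · subst hea; rwa [Function.update_self]
    · rw [Function.update_of_ne hea]
      exact h2 e (by tauto)

/-- the number of points avoiding the value `k * c e` for `e ∈ S` -/
lemma avoid_poly (d : V → ℤ) (c : E → ℤ) (F : Finset E)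
    (ih : ∀ G, G ⊂ F → ∀ w, PolyF (fun k => ((pts head tail d G w k).card : ℚ)))
    (S : Finset E) : ∀ G, G ⊆ F → S ⊆ G → ∀ w,
    PolyF (fun k => ((pts head tail d G w k).card : ℚ) -
      (((pts head tail d G w k).filter (fun x => ∀ e ∈ S, x e ≠ k * c e)).card : ℚ)) := by
  induction S using Finset.induction_on with
  | empty =>
    intro G _ _ w
    simpa using PolyF.zero
  | insert a S ha ihS =>
    intro G hG hS w
    have haG : a ∈ G := hS (mem_insert_self _ _)
    have hSG : S ⊆ G := fun e he => hS (mem_insert_of_mem he)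
    have hSG' : S ⊆ G.erase a := fun e he => mem_erase.2 ⟨by rintro rfl; exact ha he, hSG he⟩
    have hGF : G.erase a ⊂ F := (erase_ssubset haG).trans_subset hG
    have p1 := ihS G hG hSG w
    have p2 := ihS (G.erase a) hGF.subset hSG' (Function.update w a (c a))
    have p3 := ih (G.erase a) hGF (Function.update w a (c a))
    refine (p1.add (p3.sub p2)).congr fun k _ => ?_
    have hc : ((pts head tail d G w k).filter (fun x => ∀ e ∈ S, x e ≠ k * c e)).card =
        ((pts head tail d (G.erase a) (Function.update w a (c a)) k).filter
          (fun x => ∀ e ∈ S, x e ≠ k * c e)).card +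
        ((pts head tail d G w k).filter (fun x => ∀ e ∈ insert a S, x e ≠ k * c e)).card := by
      rw [pts_fix head tail haG, filter_filter, ← card_filter_add_card_filter_not
        (s := (pts head tail d G w k).filter (fun x => ∀ e ∈ S, x e ≠ k * c e))
        (fun x => x a = k * c a), filter_filter, filter_filter]
      congr 2
      · ext x; simp only [mem_filter]; tauto
      · ext x; simp only [mem_filter, forall_mem_insert]; tauto
    have hc' : (_ : ℚ) = _ := congrArg (Nat.cast (R := ℚ)) hc
    push_cast at hc'
    linarith

lemma pts_poly (d : V → ℤ) (F : Finset E) : ∀ w : E → ℤ,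
    PolyF (fun k => ((pts head tail d F w k).card : ℚ)) := by
  induction F using Finset.strongInduction with
  | _ F ih =>
  intro w
  by_cases hex : ∃ u, u ∈ pts head tail d F w 1
  · obtain ⟨u, hu⟩ := hex
    rw [mem_pts] at hu
    obtain ⟨hu1, hu2, hu3⟩ := hu
    simp only [Nat.cast_one, one_mul] at hu1 hu2 hu3
    refine PolyF.of_diff (avoid_poly head tail d (fun e => 1 - u e) F ih F F subset_rfl
      subset_rfl w) fun k hk => ?_
    congr 2
    refine Finset.card_bij' (fun x _ => x + u) (fun x _ => x - u) ?_ ?_ ?_ ?_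
    · intro x hx
      rw [mem_pts] at hx
      obtain ⟨h1, h2, h3⟩ := hx
      simp only [mem_filter, mem_pts, Pi.add_apply]
      refine ⟨⟨?_, ?_, ?_⟩, ?_⟩
      · intro e
        have := h1 e; have := hu1 e
        push_cast
        omega
      · intro e he
        rw [h2 e he, hu2 e he]; push_cast; ring
      · intro v
        simp only [add_mul, Finset.sum_add_distrib, h3 v, hu3 v]; push_cast; ring
      · intro e he h
        have := h1 e
        have h0 : u e = 0 ∨ u e = 1 := by have := hu1 e; omega
        push_cast at h
        rcases h0 with h0 | h0 <;> rw [h0] at h <;> simp at h <;> omega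
    · intro x hx
      simp only [mem_filter, mem_pts] at hx
      obtain ⟨⟨h1, h2, h3⟩, h4⟩ := hx
      rw [mem_pts]
      simp only [Pi.sub_apply]
      refine ⟨?_, ?_, ?_⟩
      · intro e
        have h0 : u e = 0 ∨ u e = 1 := by have := hu1 e; omega
        have hx := h1 e
        push_cast at hx
        by_cases he : e ∈ F
        · have h5 := h4 e he
          push_cast at h5
          rcases h0 with h0 | h0 <;> rw [h0] at h5 ⊢ <;> simp at h5 <;> omega
        · have h5 := h2 e he
          rw [← hu2 e he] at h5
          push_cast at h5
          rcases h0 with h0 | h0 <;> rw [h0] at h5 ⊢ <;> simp at h5 <;> omega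
      · intro e he
        rw [h2 e he, hu2 e he]; push_cast; ring
      · intro v
        simp only [sub_mul, Finset.sum_sub_distrib, h3 v, hu3 v]; push_cast; ring
    · intro x _; simp
    · intro x _; simp
  · refine PolyF.zero.congr fun k hk => ?_
    symm
    rw [Nat.cast_eq_zero, card_eq_zero, eq_empty_iff_forall_notMem]
    intro x hx
    apply hex
    rw [mem_pts] at hx
    obtain ⟨h1, h2, h3⟩ := hx
    have hk0 : (0 : ℚ) < k := by exact_mod_cast hk
    obtain ⟨u, hu1, hu2, hu3⟩ := rounding head tail d _ (fun e => (x e : ℚ) / k) rfl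
      (by
        intro e
        have a1 : (0 : ℚ) ≤ x e := by exact_mod_cast (h1 e).1
        have a2 : (x e : ℚ) ≤ k := by exact_mod_cast (h1 e).2
        exact ⟨div_nonneg a1 hk0.le, (div_le_one hk0).2 a2⟩)
      (by
        intro v
        have h := congrArg (Int.cast (R := ℚ)) (h3 v)
        push_cast at h
        have : ∑ e, (x e : ℚ) / k * (inc head tail e v : ℚ)
            = (∑ e, (x e : ℚ) * (inc head tail e v : ℚ)) / k := by
          rw [Finset.sum_div]
          exact Finset.sum_congr rfl fun e _ => by ring
        rw [this, h]
        field_simp)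
    refine ⟨u, ?_⟩
    rw [mem_pts]
    simp only [Nat.cast_one, one_mul]
    refine ⟨hu1, ?_, hu2⟩
    intro e he
    have hkz : (0 : ℤ) < k := by exact_mod_cast hk
    have hxe := h2 e he
    have hb := h1 e
    rw [hxe] at hb
    have w0 : 0 ≤ w e := by
      by_contra h
      nlinarith
    have w1 : w e ≤ 1 := by
      by_contra h
      nlinarith
    have hw : w e = 0 ∨ w e = 1 := by omega
    rcases hw with hw | hw
    · rw [hw]; apply (hu3 e).1; simp [hxe, hw]
    · rw [hw]; apply (hu3 e).2
      rw [hxe, hw]; push_cast; field_simp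

lemma open_poly (d : V → ℤ) (S : Finset E) : ∀ G, S ⊆ G → ∀ w,
    PolyF (fun k => (((pts head tail d G w k).filter
      (fun x => ∀ e ∈ S, x e ≠ 0 ∧ x e ≠ (k : ℤ))).card : ℚ)) := by
  induction S using Finset.induction_on with
  | empty =>
    intro G _ w
    simpa using pts_poly head tail d G w
  | insert a S ha ihS =>
    intro G hS w
    have haG : a ∈ G := hS (mem_insert_self _ _)
    have hSG : S ⊆ G := fun e he => hS (mem_insert_of_mem he)
    have hSG' : S ⊆ G.erase a := fun e he => mem_erase.2 ⟨by rintro rfl; exact ha he, hSG he⟩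
    have p1 := ihS G hSG w
    have p2 := ihS (G.erase a) hSG' (Function.update w a 0)
    have p3 := ihS (G.erase a) hSG' (Function.update w a 1)
    refine ((p1.sub p2).sub p3).congr fun k hk => ?_
    have hc : ((pts head tail d G w k).filter (fun x => ∀ e ∈ S, x e ≠ 0 ∧ x e ≠ (k : ℤ))).card =
        ((pts head tail d (G.erase a) (Function.update w a 0) k).filter
          (fun x => ∀ e ∈ S, x e ≠ 0 ∧ x e ≠ (k : ℤ))).card +
        (((pts head tail d (G.erase a) (Function.update w a 1) k).filter
          (fun x => ∀ e ∈ S, x e ≠ 0 ∧ x e ≠ (k : ℤ))).card +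
        ((pts head tail d G w k).filter
          (fun x => ∀ e ∈ insert a S, x e ≠ 0 ∧ x e ≠ (k : ℤ))).card) := by
      rw [pts_fix head tail haG, pts_fix head tail haG, filter_filter, filter_filter,
        ← card_filter_add_card_filter_not
        (s := (pts head tail d G w k).filter (fun x => ∀ e ∈ S, x e ≠ 0 ∧ x e ≠ (k : ℤ)))
        (fun x => x a = 0), filter_filter, filter_filter,
        ← card_filter_add_card_filter_not
        (s := (pts head tail d G w k).filter
          (fun x => (∀ e ∈ S, x e ≠ 0 ∧ x e ≠ (k : ℤ)) ∧ ¬ x a = 0))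
        (fun x => x a = (k : ℤ)), filter_filter, filter_filter]
      congr 2
      · ext x; simp only [mem_filter, mul_zero]; tauto
      · congr 1
        ext x; simp only [mem_filter, mul_one]
        have : x a = k → x a ≠ 0 := by intro h; omega
        tauto
      · congr 1
        ext x; simp only [mem_filter, forall_mem_insert]; tauto
    have hc' : (_ : ℚ) = _ := congrArg (Nat.cast (R := ℚ)) hc
    push_cast at hc'
    linarith

end

/-- Kochol's theorem: for every finite multigraph there is a polynomial (with rational
coefficients) whose value at each positive integer `k` is the number of nowhere-zero
integral `k`-flows. -/
theorem stmt_8 (V E : Type) [Fintype V] [Fintype E] [DecidableEq V]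
    (head tail : E → V) :
    ∃ p : Polynomial ℚ, ∀ k : ℕ, 1 ≤ k →
      p.eval (k : ℚ)
        = (Nat.card {x : E → ℤ |
            (∀ e, x e ≠ 0 ∧ |x e| < (k : ℤ)) ∧
            ∀ v : V,
              ∑ e ∈ Finset.univ.filter (fun e => head e = v), x e
                = ∑ e ∈ Finset.univ.filter (fun e => tail e = v), x e} : ℚ) := by
  classical
  let ind : Finset E → E → ℤ := fun N e => if e ∈ N then 1 else 0
  let d : Finset E → V → ℤ := fun N v => ∑ e, ind N e * inc head tail e v
  refine PolyF.congr (PolyF.sum (univ : Finset (Finset E)) _ fun N _ =>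
    open_poly head tail (d N) univ univ subset_rfl 0) fun k hk => ?_
  rw [← Nat.cast_sum, Nat.cast_inj, ← Finset.card_sigma]
  set A := (univ : Finset (Finset E)).sigma fun N =>
    (pts head tail (d N) univ 0 k).filter (fun x => ∀ e ∈ univ, x e ≠ 0 ∧ x e ≠ (k : ℤ)) with hA
  have hmem : ∀ N y, (⟨N, y⟩ : Σ _ : Finset E, (E → ℤ)) ∈ A ↔
      (∀ e, 0 < y e ∧ y e < k) ∧ ∀ v, ∑ e, y e * inc head tail e v = k * d N v := by
    intro N y
    simp only [hA, mem_sigma, mem_filter, mem_pts, mem_univ, true_and, not_true_eq_false,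
      false_imp_iff, implies_true, true_imp_iff]
    constructor
    · rintro ⟨⟨h1, h2⟩, h3⟩
      refine ⟨fun e => ?_, h2⟩
      have := h1 e; have := h3 e
      omega
    · rintro ⟨h1, h2⟩
      refine ⟨⟨fun e => ?_, h2⟩, fun e => ?_⟩ <;> have := h1 e <;> omega
  let Φ : (Σ _ : Finset E, (E → ℤ)) → E → ℤ := fun q e => q.2 e - k * ind q.1 e
  have hinj : Set.InjOn Φ A := by
    rintro ⟨N, y⟩ h1 ⟨N', y'⟩ h2 h
    have h1 := ((hmem N y).1 h1).1
    have h2 := ((hmem N' y').1 h2).1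
    have hN : N = N' := by
      ext e
      have := congrFun h e
      have a1 := h1 e
      have a2 := h2 e
      simp only [Φ, ind] at this
      by_cases b1 : e ∈ N <;> by_cases b2 : e ∈ N' <;> simp [b1, b2] at this ⊢ <;> omega
    subst hN
    have hy : y = y' := by
      ext e
      have := congrFun h e
      simpa [Φ] using this
    rw [hy]
  have hT : {x : E → ℤ | (∀ e, x e ≠ 0 ∧ |x e| < (k : ℤ)) ∧ ∀ v : V,
      ∑ e ∈ Finset.univ.filter (fun e => head e = v), x e
        = ∑ e ∈ Finset.univ.filter (fun e => tail e = v), x e} = ↑(A.image Φ) := by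
    ext x
    simp only [Set.mem_setOf_eq, coe_image, Set.mem_image, mem_coe]
    have hk' : (0 : ℤ) < k := by exact_mod_cast hk
    constructor
    · rintro ⟨h1, h2⟩
      refine ⟨⟨univ.filter (fun e => x e < 0), fun e => x e + k * ind
        (univ.filter (fun e => x e < 0)) e⟩, ?_, ?_⟩
      · rw [hmem]
        constructor
        · intro e
          obtain ⟨a1, a2⟩ := h1 e
          rw [abs_lt] at a2
          by_cases b : x e < 0 <;> simp [ind, b] <;> omega
        · intro v
          have := inc_sum head tail x v
          rw [h2 v, sub_self] at this
          simp only [add_mul, Finset.sum_add_distrib, this, d, Finset.mul_sum, mul_assoc, zero_add]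
      · ext e
        simp [Φ]
    · rintro ⟨⟨N, y⟩, hq, rfl⟩
      rw [hmem] at hq
      obtain ⟨h1, h2⟩ := hq
      constructor
      · intro e
        have := h1 e
        rw [abs_lt]
        by_cases b : e ∈ N <;> simp [Φ, ind, b] <;> omega
      · intro v
        rw [← sub_eq_zero, ← inc_sum]
        simp only [Φ, sub_mul, Finset.sum_sub_distrib, h2 v, d, Finset.mul_sum, mul_assoc, sub_self]
  rw [hT, Nat.card_coe_set_eq, Set.ncard_coe_finset, card_image_of_injOn hinj]
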